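/- Let η be the exponential probability measure e^{-x}1_{x≥0}dx on ℝ and η^n its n-fold product. Let Λ_η(s) = log ∫ e^{sx} dη(x) = -log(1-s) for s < 1. Then for every countable subset V ⊂ (-∞,1)^n, log ∫ exp( sup_{ξ ∈ V} ( ⟨ξ,x⟩ - Λ_{η^n}(ξ) ) ) dη^n(x) ≤ ∫ sup_{ξ ∈ V} ⟨Λ_η(ξ), x - u⟩ dη^n(x), where Λ_{η^n}(ξ) = Σ_{i=1}^n Λ_η(ξ_i), u = (1,1,…,1) ∈ ℝ^n, and Λ_η(ξ) denotes the vector (Λ_η(ξ_1),…,Λ_η(ξ_n)). -/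

import Mathlib

open MeasureTheory Real Set ENNReal
open scoped Classical

/-- The exponential probability measure `e^{-x} 1_{x ≥ 0} dx` on `ℝ`. -/
noncomputable def expMeasure : Measure ℝ :=
  volume.withDensity fun x => ENNReal.ofReal (if 0 ≤ x then Real.exp (-x) else 0)

/-- The logarithmic Laplace transform of the exponential measure:
`Λ_η(s) = -log (1 - s)` for `s < 1`. -/
noncomputable def expLogLaplace (s : ℝ) : ℝ := -Real.log (1 - s)

/-- The transport cost `x Λ*(y / x)`, with `Λ*(t) = t - 1 - log t`. -/
noncomputable def expCost (x y : ℝ) : ℝ := y - x - x * (Real.log y - Real.log x)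

theorem mul_sub_mul_expLogLaplace_le_expCost {s x y : ℝ} (hs : s < 1) (hx : 0 < x) (hy : 0 < y) :
    s * y - x * expLogLaplace s ≤ expCost x y := by
  have hr : 0 < 1 - s := by linarith
  have h := Real.log_le_sub_one_of_pos (show 0 < (1 - s) * y / x by positivity)
  rw [Real.log_div (by positivity) hx.ne', Real.log_mul hr.ne' hy.ne'] at h
  have h2 := mul_le_mul_of_nonneg_left h hx.le
  have h3 : x * ((1 - s) * y / x - 1) = (1 - s) * y - x := by field_simp
  unfold expCost expLogLaplace
  nlinarith

theorem tendsto_integral_sub_intervalIntegral {f : ℝ → ℝ} (hf : IntegrableOn f (Ioi 0)) :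
    Filter.Tendsto (fun b => (∫ y in Ioi 0, f y) - ∫ y in (0 : ℝ)..b, f y) Filter.atTop
      (nhds 0) := by
  have h := intervalIntegral_tendsto_integral_Ioi 0 hf Filter.tendsto_id
  simpa using (tendsto_const_nhds (x := ∫ y in Ioi 0, f y)).sub h

theorem integral_Ioi_sub_intervalIntegral {f : ℝ → ℝ} (hf : IntegrableOn f (Ioi 0)) {b : ℝ}
    (hb : 0 ≤ b) : (∫ y in Ioi 0, f y) - ∫ y in (0 : ℝ)..b, f y = ∫ y in Ioi b, f y := by
  rw [sub_eq_iff_eq_add', intervalIntegral.integral_interval_add_Ioi hf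
    (hf.mono_set (Ioi_subset_Ioi hb))]

/-- One-dimensional transport-entropy inequality for the exponential measure, in dual form. The map
`S = -log (B / Z)` below sends the probability density `exp (G y - y) / Z` on `(0, ∞)` to the
exponential measure, and `Φ` interpolates between the two sides. -/
theorem log_integral_exp_le_of_le_add_expCost {G h : ℝ → ℝ} (hG : Continuous G)
    (hh : Continuous h) (hGi : IntegrableOn (fun y => Real.exp (G y - y)) (Ioi 0))
    (hGi' : IntegrableOn (fun y => y * Real.exp (G y - y)) (Ioi 0))
    (hhi : IntegrableOn (fun x => h x * Real.exp (-x)) (Ioi 0))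
    (hGh : ∀ x y, 0 < x → 0 < y → G y ≤ h x + expCost x y) :
    Real.log (∫ y in Ioi 0, Real.exp (G y - y)) ≤ ∫ x in Ioi 0, h x * Real.exp (-x) := by
  set g : ℝ → ℝ := fun y => Real.exp (G y - y) with hg
  have hgc : Continuous g := by fun_prop
  have hgpos : ∀ y, 0 < g y := fun y => Real.exp_pos _
  set Z := ∫ y in Ioi 0, g y with hZ
  set B : ℝ → ℝ := fun b => Z - ∫ y in (0 : ℝ)..b, g y with hB
  have hBeq : ∀ b, 0 ≤ b → B b = ∫ y in Ioi b, g y := fun b hb =>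
    integral_Ioi_sub_intervalIntegral hGi hb
  have hBpos : ∀ b, 0 ≤ b → 0 < B b := by
    intro b hb
    rw [hBeq b hb]
    have : NeZero (volume.restrict (Ioi b)) := ⟨by simp⟩
    exact integral_exp_pos (hGi.mono_set (Ioi_subset_Ioi hb))
  have hB0 : B 0 = Z := by simp [hB]
  have hZpos : 0 < Z := hB0 ▸ hBpos 0 le_rfl
  have hBlt : ∀ b, 0 < b → B b < Z := by
    intro b hb
    have := intervalIntegral.intervalIntegral_pos_of_pos (hgc.intervalIntegrable 0 b) hgpos hb
    simp only [hB]; linarith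
  have hBd : ∀ y, HasDerivAt B (-g y) y := by
    intro y
    simpa using (intervalIntegral.integral_hasDerivAt_right (hgc.intervalIntegrable 0 y)
      (hgc.stronglyMeasurableAtFilter _ _) hgc.continuousAt).const_sub Z
  have hBtop : Filter.Tendsto B Filter.atTop (nhds 0) :=
    tendsto_integral_sub_intervalIntegral hGi
  set S : ℝ → ℝ := fun y => Real.log Z - Real.log (B y) with hS
  have hSpos : ∀ y, 0 < y → 0 < S y := fun y hy =>
    sub_pos.2 (Real.log_lt_log (hBpos y hy.le) (hBlt y hy))
  have hS0 : S 0 = 0 := by simp [hS, hB0]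
  have hSd : ∀ y, 0 ≤ y → HasDerivAt S (g y / B y) y := by
    intro y hy
    have := ((hBd y).log (hBpos y hy).ne').const_sub (Real.log Z)
    rwa [neg_div, neg_neg] at this
  have hexpS : ∀ y, 0 ≤ y → Real.exp (-S y) = B y / Z := by
    intro y hy
    simp only [hS]
    rw [neg_sub, Real.exp_sub, Real.exp_log (hBpos y hy), Real.exp_log hZpos]
  have hStop : Filter.Tendsto S Filter.atTop Filter.atTop := by
    have h1 : Filter.Tendsto B Filter.atTop (nhdsWithin 0 (Ioi 0)) :=
      tendsto_nhdsWithin_iff.2 ⟨hBtop, by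
        filter_upwards [Filter.eventually_ge_atTop 0] with y hy using hBpos y hy⟩
    simpa [hS, sub_eq_add_neg] using Filter.tendsto_atTop_add_const_left _ (Real.log Z)
      (Filter.tendsto_neg_atBot_atTop.comp (Real.tendsto_log_nhdsGT_zero.comp h1))
  set K : ℝ → ℝ := fun s => ∫ x in (0 : ℝ)..s, h x * Real.exp (-x) with hK
  have hkc : Continuous fun x => h x * Real.exp (-x) := by fun_prop
  have hKd : ∀ s, HasDerivAt K (h s * Real.exp (-s)) s := fun s =>
    intervalIntegral.integral_hasDerivAt_right (hkc.intervalIntegrable 0 s)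
      (hkc.stronglyMeasurableAtFilter _ _) hkc.continuousAt
  have hKtop : Filter.Tendsto (fun y => K (S y)) Filter.atTop
      (nhds (∫ x in Ioi 0, h x * Real.exp (-x))) :=
    intervalIntegral_tendsto_integral_Ioi 0 hhi hStop
  set Φ : ℝ → ℝ := fun y =>
    S y * (Real.log y - Real.log (S y)) * (B y / Z) + K (S y) + Real.log Z * (B y / Z) with hΦ
  have hΦd : ∀ y, 0 < y → HasDerivAt Φ
      ((g y / B y * (Real.log y - Real.log (S y)) + S y * (y⁻¹ - g y / B y / S y)) * (B y / Z)
        + S y * (Real.log y - Real.log (S y)) * (-g y / Z)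
        + h (S y) * Real.exp (-S y) * (g y / B y) + Real.log Z * (-g y / Z)) y := by
    intro y hy
    have hs := hSd y hy.le
    exact (((hs.mul ((Real.hasDerivAt_log hy.ne').sub (hs.log (hSpos y hy).ne'))).mul
      ((hBd y).div_const Z)).add ((hKd (S y)).comp y hs)).add
      (((hBd y).div_const Z).const_mul (Real.log Z))
  have hΦmono : MonotoneOn Φ (Ioi 0) := by
    refine monotoneOn_of_deriv_nonneg (convex_Ioi 0)
      (fun y hy => (hΦd y hy).continuousAt.continuousWithinAt)
      (fun y hy => (hΦd y (by simpa using hy)).differentiableAt.differentiableWithinAt) ?_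
    intro y hy
    have hy : 0 < y := by simpa using hy
    rw [(hΦd y hy).deriv, hexpS y hy.le]
    have hb := hBpos y hy.le
    have hs := hSpos y hy
    have hgy := hgpos y
    have hu := Real.log_le_sub_one_of_pos (show 0 < S y * B y / (y * g y) by positivity)
    rw [Real.log_div (by positivity) (by positivity), Real.log_mul hs.ne' hb.ne',
      Real.log_mul hy.ne' hgy.ne'] at hu
    have hlg : Real.log (g y) = G y - y := Real.log_exp _
    have hcost := hGh (S y) y hs hy
    have hSy : S y = Real.log Z - Real.log (B y) := rfl
    unfold expCost at hcost
    have key : 0 ≤ (Real.log y - Real.log (S y)) + S y * B y / (y * g y) - 1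
        - S y * (Real.log y - Real.log (S y)) + h (S y) - Real.log Z := by linarith
    have := mul_nonneg key (show 0 ≤ g y / Z by positivity)
    refine this.trans_eq ?_
    field_simp
    ring
  have hlow : Filter.Tendsto
      (fun y => (S y - S y * (S y / y)) * (B y / Z) + K (S y) + Real.log Z * (B y / Z))
      (nhdsWithin 0 (Ioi 0)) (nhds (Real.log Z)) := by
    have hSc : Filter.Tendsto S (nhdsWithin 0 (Ioi 0)) (nhds 0) := by
      have := (hSd 0 le_rfl).continuousAt.tendsto
      rw [hS0] at this
      exact this.mono_left nhdsWithin_le_nhds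
    have hBc : Filter.Tendsto (fun y => B y / Z) (nhdsWithin 0 (Ioi 0)) (nhds 1) := by
      have := (hBd 0).continuousAt.tendsto.div_const Z
      rw [hB0, div_self hZpos.ne'] at this
      exact this.mono_left nhdsWithin_le_nhds
    have hKc : Filter.Tendsto (fun y => K (S y)) (nhdsWithin 0 (Ioi 0)) (nhds 0) := by
      have h0 : K 0 = 0 := by simp [hK]
      have := (hKd 0).continuousAt.tendsto
      rw [h0] at this
      exact this.comp hSc
    have hsl : Filter.Tendsto (fun y => S y / y) (nhdsWithin 0 (Ioi 0)) (nhds (g 0 / B 0)) := by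
      have := (hasDerivAt_iff_tendsto_slope.1 (hSd 0 le_rfl)).mono_left
        (nhdsWithin_mono 0 (fun y (hy : 0 < y) => hy.ne'))
      refine this.congr fun y => ?_
      simp [slope_def_field, hS0]
    have := (((hSc.sub (hSc.mul hsl)).mul hBc).add hKc).add (hBc.const_mul (Real.log Z))
    simpa using this
  have hup : Filter.Tendsto
      (fun y => ((∫ t in Ioi 0, t * g t) - ∫ t in (0 : ℝ)..y, t * g t) / Z + K (S y)
        + Real.log Z * (B y / Z))
      Filter.atTop (nhds (∫ x in Ioi 0, h x * Real.exp (-x))) := by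
    have := (((tendsto_integral_sub_intervalIntegral hGi').div_const Z).add hKtop).add
      ((hBtop.div_const Z).const_mul (Real.log Z))
    simpa using this
  have hle : ∀ y, 0 < y → Real.log Z ≤ Φ y := by
    intro y hy
    refine le_of_tendsto hlow ?_
    filter_upwards [Ioo_mem_nhdsGT hy] with a ha
    refine le_trans ?_ (hΦmono ha.1 hy ha.2.le)
    have hs := hSpos a ha.1
    have hb := hBpos a ha.1.le
    have ha0 : 0 < a := ha.1
    have h1 := Real.log_le_sub_one_of_pos (show 0 < S a / a by positivity)
    rw [Real.log_div hs.ne' ha0.ne'] at h1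
    simp only [hΦ]
    gcongr
    nlinarith
  refine ge_of_tendsto hup ?_
  filter_upwards [Filter.eventually_gt_atTop 0] with y hy
  refine (hle y hy).trans ?_
  have hs := hSpos y hy
  have hb := hBpos y hy.le
  have h1 := Real.log_le_sub_one_of_pos (show 0 < y / S y by positivity)
  rw [Real.log_div hy.ne' hs.ne'] at h1
  have h2 : S y * (Real.log y - Real.log (S y)) ≤ y := by
    have := mul_le_mul_of_nonneg_left h1 hs.le
    have h3 : S y * (y / S y - 1) = y - S y := by field_simp
    linarith
  have h4 : y * B y ≤ (∫ t in Ioi 0, t * g t) - ∫ t in (0 : ℝ)..y, t * g t := by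
    rw [integral_Ioi_sub_intervalIntegral hGi' hy.le, hBeq y hy.le, ← integral_const_mul]
    refine setIntegral_mono_on ((hGi.mono_set (Ioi_subset_Ioi hy.le)).const_mul y)
      (hGi'.mono_set (Ioi_subset_Ioi hy.le)) measurableSet_Ioi fun t ht => ?_
    exact mul_le_mul_of_nonneg_right (le_of_lt ht) (hgpos t).le
  simp only [hΦ]
  gcongr
  rw [← mul_div_assoc]
  gcongr
  exact (mul_le_mul_of_nonneg_right h2 hb.le).trans h4

theorem expMeasure_eq_withDensity_restrict : expMeasure =
    (volume.restrict (Ioi 0)).withDensity fun x => ENNReal.ofReal (Real.exp (-x)) := by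
  rw [← Measure.restrict_congr_set Ioi_ae_eq_Ici.symm, ← withDensity_indicator measurableSet_Ici,
    expMeasure]
  congr 1
  ext x
  by_cases hx : 0 ≤ x <;> simp [indicator, hx]

theorem integral_expMeasure (f : ℝ → ℝ) :
    ∫ x, f x ∂expMeasure = ∫ x in Ioi 0, f x * Real.exp (-x) := by
  rw [expMeasure_eq_withDensity_restrict,
    integral_withDensity_eq_integral_toReal_smul (by fun_prop) (by simp)]
  simp [(Real.exp_pos _).le, mul_comm]

theorem integrable_expMeasure_iff {f : ℝ → ℝ} :
    Integrable f expMeasure ↔ IntegrableOn (fun x => f x * Real.exp (-x)) (Ioi 0) := by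
  rw [expMeasure_eq_withDensity_restrict,
    integrable_withDensity_iff_integrable_smul' (by fun_prop) (by simp)]
  simp [(Real.exp_pos _).le, mul_comm, IntegrableOn]

instance isProbabilityMeasure_expMeasure : IsProbabilityMeasure expMeasure := by
  have h := integral_expMeasure fun _ => 1
  simp only [one_mul, integral_exp_neg_Ioi_zero, integral_const, smul_eq_mul, mul_one] at h
  refine ⟨?_⟩
  rw [← ENNReal.toReal_eq_one_iff]
  exact h

theorem ae_pos_expMeasure : ∀ᵐ x ∂expMeasure, 0 < x := by
  rw [expMeasure_eq_withDensity_restrict]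
  exact (withDensity_absolutelyContinuous _ _).ae_le (ae_restrict_mem measurableSet_Ioi)

theorem ae_pos_pi_expMeasure {ι : Type*} [Fintype ι] :
    ∀ᵐ y ∂(Measure.pi fun _ : ι => expMeasure), ∀ i, 0 < y i :=
  Filter.eventually_all.2 fun i =>
    (measurePreserving_eval (fun _ : ι => expMeasure) i).quasiMeasurePreserving.ae
      ae_pos_expMeasure

theorem integrable_exp_mul_expMeasure {c : ℝ} (hc : c < 1) :
    Integrable (fun x => Real.exp (c * x)) expMeasure := by
  rw [integrable_expMeasure_iff]
  refine (exp_neg_integrableOn_Ioi 0 (sub_pos.2 hc)).congr_fun (fun x _ => ?_) measurableSet_Ioi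
  rw [← Real.exp_add]
  ring_nf

theorem integrable_mul_exp_mul_expMeasure {c : ℝ} (hc : c < 1) :
    Integrable (fun x => x * Real.exp (c * x)) expMeasure := by
  obtain ⟨d, hcd, hd⟩ := exists_between hc
  refine ((integrable_exp_mul_expMeasure hd).const_mul (d - c)⁻¹).mono'
    (by fun_prop) ?_
  filter_upwards [ae_pos_expMeasure] with x hx
  have hdc : 0 < d - c := sub_pos.2 hcd
  rw [Real.norm_of_nonneg (by positivity), inv_mul_eq_div, le_div_iff₀ hdc]
  have h1 := Real.add_one_le_exp ((d - c) * x)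
  have h2 : Real.exp (d * x) = Real.exp ((d - c) * x) * Real.exp (c * x) := by
    rw [← Real.exp_add]; ring_nf
  rw [h2]
  nlinarith [Real.exp_pos (c * x)]

/-- The asymmetric distance with slope `a` upwards and slope `b` downwards. -/
noncomputable def asymDist (a b s t : ℝ) : ℝ := a * max (s - t) 0 + b * max (t - s) 0

theorem asymDist_self (a b s : ℝ) : asymDist a b s s = 0 := by simp [asymDist]

theorem asymDist_of_pos_zero (a b : ℝ) {s : ℝ} (hs : 0 < s) : asymDist a b s 0 = a * s := by
  simp [asymDist, hs.le]

theorem asymDist_zero_of_pos (a b : ℝ) {s : ℝ} (hs : 0 < s) : asymDist a b 0 s = b * s := by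
  simp [asymDist, hs.le]

theorem mul_sub_le_asymDist {a b v : ℝ} (hva : v ≤ a) (hvb : -b ≤ v) (s t : ℝ) :
    v * (s - t) ≤ asymDist a b s t := by
  unfold asymDist
  rcases le_total s t with h | h
  · rw [max_eq_right (by linarith), max_eq_left (by linarith)]
    nlinarith
  · rw [max_eq_left (by linarith), max_eq_right (by linarith)]
    nlinarith

/-- `F` grows with slope at most `a` and decreases with slope at most `b` in each coordinate. -/
def HasSlopeBounds {ι : Type*} [Fintype ι] (a b : ℝ) (F : (ι → ℝ) → ℝ) : Prop :=
  ∀ y z, F y ≤ F z + ∑ i, asymDist a b (y i) (z i)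

namespace HasSlopeBounds

variable {ι : Type*} [Fintype ι] {a b : ℝ} {F : (ι → ℝ) → ℝ}

theorem continuous (hF : HasSlopeBounds a b F) : Continuous F := by
  refine continuous_iff_continuousAt.2 fun z => ?_
  have hc : Continuous fun p : ℝ × ℝ => asymDist a b p.1 p.2 := by
    unfold asymDist; fun_prop
  have h1 : Continuous fun y : ι → ℝ => F z + ∑ i, asymDist a b (y i) (z i) :=
    continuous_const.add (continuous_finsetSum _ fun i _ =>
      hc.comp₂ (continuous_apply i) continuous_const)
  have h2 : Continuous fun y : ι → ℝ => F z - ∑ i, asymDist a b (z i) (y i) :=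
    continuous_const.sub (continuous_finsetSum _ fun i _ =>
      hc.comp₂ continuous_const (continuous_apply i))
  refine tendsto_of_tendsto_of_tendsto_of_le_of_le
    (by simpa [asymDist_self] using h2.tendsto z) (by simpa [asymDist_self] using h1.tendsto z)
    (fun y => ?_) (fun y => hF y z)
  have := hF z y
  simp only
  linarith

theorem add_const (hF : HasSlopeBounds a b F) (k : ℝ) : HasSlopeBounds a b fun y => F y + k :=
  fun y z => by have := hF y z; linarith

theorem ciSup {κ : Type*} [Nonempty κ] {f : κ → (ι → ℝ) → ℝ}
    (hf : ∀ k, HasSlopeBounds a b (f k)) (hbdd : ∀ x, BddAbove (range fun k => f k x)) :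
    HasSlopeBounds a b fun x => ⨆ k, f k x := fun y z =>
  ciSup_le fun k => (hf k y z).trans (by gcongr; exact le_ciSup (hbdd z) k)

theorem cons {n : ℕ} {F : (Fin (n + 1) → ℝ) → ℝ} (hF : HasSlopeBounds a b F) (t : ℝ) :
    HasSlopeBounds a b fun y : Fin n → ℝ => F (Fin.cons t y) := fun y z => by
  simpa [Fin.sum_univ_succ, asymDist_self] using hF (Fin.cons t y) (Fin.cons t z)

theorem cons_le {n : ℕ} {F : (Fin (n + 1) → ℝ) → ℝ} (hF : HasSlopeBounds a b F) (s t : ℝ)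
    (y : Fin n → ℝ) : F (Fin.cons s y) ≤ F (Fin.cons t y) + asymDist a b s t := by
  simpa [Fin.sum_univ_succ, asymDist_self] using hF (Fin.cons s y) (Fin.cons t y)

theorem integrable_exp (hF : HasSlopeBounds a b F) (ha : a < 1) :
    Integrable (fun y => Real.exp (F y)) (Measure.pi fun _ : ι => expMeasure) := by
  have hi : Integrable (fun y : ι → ℝ => ∏ i, Real.exp (a * y i))
      (Measure.pi fun _ : ι => expMeasure) :=
    Integrable.fintype_prod fun _ => integrable_exp_mul_expMeasure ha
  refine (hi.const_mul (Real.exp (F 0))).mono'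
    (Real.continuous_exp.comp hF.continuous).aestronglyMeasurable ?_
  filter_upwards [ae_pos_pi_expMeasure] with y hy
  rw [Real.norm_of_nonneg (Real.exp_pos _).le, ← Real.exp_sum, ← Real.exp_add, Real.exp_le_exp]
  refine (hF y 0).trans_eq ?_
  simp [asymDist_of_pos_zero, hy]

theorem integrable (hF : HasSlopeBounds a b F) :
    Integrable F (Measure.pi fun _ : ι => expMeasure) := by
  have hid : Integrable (fun x => x) expMeasure := by
    simpa using integrable_mul_exp_mul_expMeasure zero_lt_one
  have hi (k : ℝ) : Integrable (fun y : ι → ℝ => ∑ i, k * y i)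
      (Measure.pi fun _ : ι => expMeasure) :=
    integrable_finsetSum _ fun i _ =>
      (integrable_comp_eval (μ := fun _ : ι => expMeasure) (i := i) hid).const_mul k
  refine integrable_of_le_of_le hF.continuous.aestronglyMeasurable
    (g₁ := fun y => F 0 - ∑ i, b * y i) (g₂ := fun y => F 0 + ∑ i, a * y i) ?_ ?_
    ((integrable_const _).sub (hi b)) ((integrable_const _).add (hi a))
  · filter_upwards [ae_pos_pi_expMeasure] with y hy
    have := hF 0 y
    simpa [asymDist_zero_of_pos, hy] using this
  · filter_upwards [ae_pos_pi_expMeasure] with y hy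
    have := hF y 0
    simpa [asymDist_of_pos_zero, hy] using this

end HasSlopeBounds

theorem piFinSuccAbove_zero_symm_apply {n : ℕ} (p : ℝ × (Fin n → ℝ)) :
    (MeasurableEquiv.piFinSuccAbove (fun _ : Fin (n + 1) => ℝ) 0).symm p = Fin.cons p.1 p.2 := by
  simp [MeasurableEquiv.piFinSuccAbove_symm_apply, Fin.consEquiv]

theorem integrable_comp_fin_cons {n : ℕ} {f : (Fin (n + 1) → ℝ) → ℝ}
    (hf : Integrable f (Measure.pi fun _ => expMeasure)) :
    Integrable (fun p : ℝ × (Fin n → ℝ) => f (Fin.cons p.1 p.2))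
      (expMeasure.prod (Measure.pi fun _ => expMeasure)) := by
  simp only [← piFinSuccAbove_zero_symm_apply]
  exact ((measurePreserving_piFinSuccAbove (fun _ : Fin (n + 1) => expMeasure) 0).symm
    |>.integrable_comp_emb (MeasurableEquiv.measurableEmbedding _)).2 hf

theorem integral_pi_fin_succ {n : ℕ} {f : (Fin (n + 1) → ℝ) → ℝ}
    (hf : Integrable f (Measure.pi fun _ => expMeasure)) :
    ∫ x, f x ∂(Measure.pi fun _ => expMeasure) =
      ∫ t, ∫ y, f (Fin.cons t y) ∂(Measure.pi fun _ : Fin n => expMeasure) ∂expMeasure := by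
  have hm := (measurePreserving_piFinSuccAbove (fun _ : Fin (n + 1) => expMeasure) 0).symm
  rw [← hm.integral_comp']
  simp only [piFinSuccAbove_zero_symm_apply]
  exact integral_prod _ (integrable_comp_fin_cons hf)

/-- Dual transport-entropy inequality for products of the exponential measure. -/
theorem log_integral_exp_le_integral_of_hasSlopeBounds {c L M N : ℝ} (hc : c < 1)
    (n : ℕ) (G h : (Fin n → ℝ) → ℝ) (hG : HasSlopeBounds c L G) (hh : HasSlopeBounds M N h)
    (hGh : ∀ x y, (∀ i, 0 < x i) → (∀ i, 0 < y i) → G y ≤ h x + ∑ i, expCost (x i) (y i)) :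
    Real.log (∫ y, Real.exp (G y) ∂(Measure.pi fun _ => expMeasure)) ≤
      ∫ x, h x ∂(Measure.pi fun _ => expMeasure) := by
  induction n with
  | zero =>
    have := hGh 0 0 (fun i => i.elim0) (fun i => i.elim0)
    simpa [Measure.pi_of_empty _ (0 : Fin 0 → ℝ)] using this
  | succ n ih =>
    set G₁ : ℝ → ℝ := fun s =>
      Real.log (∫ y, Real.exp (G (Fin.cons s y)) ∂(Measure.pi fun _ => expMeasure)) with hG₁
    set h₁ : ℝ → ℝ := fun t => ∫ x, h (Fin.cons t x) ∂(Measure.pi fun _ => expMeasure) with hh₁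
    have hGi (s : ℝ) := (hG.cons s).integrable_exp hc
    have hhi (t : ℝ) := (hh.cons t).integrable
    have hexp (s : ℝ) : Real.exp (G₁ s) =
        ∫ y, Real.exp (G (Fin.cons s y)) ∂(Measure.pi fun _ => expMeasure) :=
      Real.exp_log (integral_exp_pos (hGi s))
    have hG₁b (s t : ℝ) : G₁ s ≤ G₁ t + asymDist c L s t := by
      rw [← Real.exp_le_exp, Real.exp_add, hexp, hexp, ← integral_mul_const]
      refine integral_mono (hGi s) ((hGi t).mul_const _) fun y => ?_
      simp only
      rw [← Real.exp_add, Real.exp_le_exp]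
      exact hG.cons_le s t y
    have hh₁b (s t : ℝ) : h₁ s ≤ h₁ t + asymDist M N s t := by
      have : h₁ t + asymDist M N s t = ∫ x, (h (Fin.cons t x) + asymDist M N s t)
          ∂(Measure.pi fun _ => expMeasure) := by
        rw [integral_add (hhi t) (integrable_const _)]
        simp [hh₁]
      rw [this]
      exact integral_mono (hhi s) ((hhi t).add (integrable_const _)) fun y => hh.cons_le s t y
    have hG₁s : HasSlopeBounds c L fun y : Unit → ℝ => G₁ (y ()) := fun y z => by
      simpa using hG₁b (y ()) (z ())
    have hh₁s : HasSlopeBounds M N fun y : Unit → ℝ => h₁ (y ()) := fun y z => by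
      simpa using hh₁b (y ()) (z ())
    have hG₁c : Continuous G₁ :=
      hG₁s.continuous.comp (continuous_pi fun _ => continuous_id)
    have hh₁c : Continuous h₁ :=
      hh₁s.continuous.comp (continuous_pi fun _ => continuous_id)
    have hcost (t s : ℝ) (ht : 0 < t) (hs : 0 < s) : G₁ s ≤ h₁ t + expCost t s := by
      have : h₁ t + expCost t s = ∫ x, (h (Fin.cons t x) + expCost t s)
          ∂(Measure.pi fun _ => expMeasure) := by
        rw [integral_add (hhi t) (integrable_const _)]
        simp [hh₁]
      rw [this]
      refine ih _ _ (hG.cons s) ((hh.cons t).add_const _) fun x y hx hy => ?_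
      have := hGh (Fin.cons t x) (Fin.cons s y) (Fin.cases ht hx) (Fin.cases hs hy)
      simp only [Fin.sum_univ_succ, Fin.cons_zero, Fin.cons_succ] at this
      linarith
    rw [integral_pi_fin_succ (hG.integrable_exp hc), integral_pi_fin_succ hh.integrable]
    have hG₁i : Integrable (fun s => Real.exp (G₁ s)) expMeasure := by
      simp only [hexp]
      exact (integrable_comp_fin_cons (hG.integrable_exp hc)).integral_prod_left
    have hG₁i' : Integrable (fun s => s * Real.exp (G₁ s)) expMeasure := by
      refine ((integrable_mul_exp_mul_expMeasure hc).const_mul (Real.exp (G₁ 0))).mono'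
        (by fun_prop) ?_
      filter_upwards [ae_pos_expMeasure] with s hs
      rw [Real.norm_of_nonneg (by positivity), mul_left_comm, ← Real.exp_add]
      gcongr
      simpa [asymDist_of_pos_zero, hs] using hG₁b s 0
    have hh₁i : Integrable h₁ expMeasure :=
      (integrable_comp_fin_cons hh.integrable).integral_prod_left
    rw [integrable_expMeasure_iff] at hG₁i hG₁i' hh₁i
    simp only [← hexp]
    rw [integral_expMeasure, integral_expMeasure]
    simp only [mul_assoc, ← Real.exp_add, ← sub_eq_add_neg] at hG₁i hG₁i' ⊢
    exact log_integral_exp_le_of_le_add_expCost hG₁c hh₁c hG₁i hG₁i' hh₁i hcost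

/-- **Strong integrability of exponential processes.** For every countable
`V ⊆ (-∞, 1)ⁿ`,
`log ∫ exp (sup_{ξ ∈ V} (⟨ξ,x⟩ - Λ_{ηⁿ}(ξ))) dηⁿ(x) ≤ ∫ sup_{ξ ∈ V} ⟨Λ_η(ξ), x - u⟩ dηⁿ(x)`,
where `u = (1,…,1)` and `Λ_η(ξ) = (Λ_η(ξ₁),…,Λ_η(ξₙ))`. -/
theorem strong_integrability_exponential (n : ℕ) (V : Set (Fin n → ℝ))
    (hV : V.Countable) (hne : V.Nonempty) (hlt : ∀ ξ ∈ V, ∀ i, ξ i < 1)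
    (hbdd1 : ∀ x : Fin n → ℝ,
      BddAbove ((fun ξ : Fin n → ℝ => ∑ i, ξ i * x i - ∑ i, expLogLaplace (ξ i)) '' V))
    (hbdd2 : ∀ x : Fin n → ℝ,
      BddAbove ((fun ξ : Fin n → ℝ => ∑ i, expLogLaplace (ξ i) * (x i - 1)) '' V)) :
    Real.log (∫ x, Real.exp (⨆ ξ : V,
        (∑ i, (ξ : Fin n → ℝ) i * x i - ∑ i, expLogLaplace ((ξ : Fin n → ℝ) i)))
        ∂(Measure.pi fun _ : Fin n => expMeasure)) ≤
      ∫ x, (⨆ ξ : V, ∑ i, expLogLaplace ((ξ : Fin n → ℝ) i) * (x i - 1))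
        ∂(Measure.pi fun _ : Fin n => expMeasure) := by
  have : Nonempty V := hne.to_subtype
  simp only [image_eq_range] at hbdd1 hbdd2
  obtain ⟨M, hM⟩ : ∃ M, ∀ ξ ∈ V, ∀ i, |expLogLaplace (ξ i)| ≤ M := by
    have hsign (i : Fin n) (ε : ℝ) : ∃ K, ∀ ξ ∈ V, expLogLaplace (ξ i) * ε ≤ K := by
      obtain ⟨K, hK⟩ := hbdd2 (fun j => 1 + if j = i then ε else 0)
      refine ⟨K, fun ξ hξ => ?_⟩
      simpa using hK ⟨⟨ξ, hξ⟩, rfl⟩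
    choose K hK using hsign
    refine ⟨∑ i, max |K i 1| |K i (-1)|, fun ξ hξ i => ?_⟩
    refine le_trans ?_ (Finset.single_le_sum (f := fun i => max |K i 1| |K i (-1)|)
      (fun j _ => le_max_of_le_left (abs_nonneg _)) (Finset.mem_univ i))
    have h1 := (hK i 1 ξ hξ).trans (le_abs_self _)
    have h2 := (hK i (-1) ξ hξ).trans (le_abs_self _)
    refine abs_le'.2 ⟨le_max_of_le_left (by linarith), le_max_of_le_right (by linarith)⟩
  have hcoord (ξ) (hξ : ξ ∈ V) (i) :
      ξ i ≤ 1 - Real.exp (-M) ∧ -(Real.exp M) ≤ ξ i := by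
    have hr : 0 < 1 - ξ i := sub_pos.2 (hlt ξ hξ i)
    have h := abs_le.1 (hM ξ hξ i)
    unfold expLogLaplace at h
    have h1 := (Real.le_log_iff_exp_le hr).1 (show -M ≤ _ by linarith [h.2])
    have h2 := (Real.log_le_iff_le_exp hr).1 (show _ ≤ M by linarith [h.1])
    constructor <;> linarith
  refine log_integral_exp_le_integral_of_hasSlopeBounds (c := 1 - Real.exp (-M))
    (L := Real.exp M) (M := M) (N := M) (by linarith [Real.exp_pos (-M)]) n _ _
    (HasSlopeBounds.ciSup (fun ξ y z => ?_) hbdd1)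
    (HasSlopeBounds.ciSup (fun ξ y z => ?_) hbdd2) fun x y hx hy => ciSup_le fun ξ => ?_
  · have := Finset.sum_le_sum fun i (_ : i ∈ Finset.univ) =>
      mul_sub_le_asymDist (hcoord ξ ξ.2 i).1 (hcoord ξ ξ.2 i).2 (y i) (z i)
    simp only [mul_sub, Finset.sum_sub_distrib] at this
    linarith
  · have := Finset.sum_le_sum fun i (_ : i ∈ Finset.univ) =>
      mul_sub_le_asymDist (abs_le.1 (hM ξ ξ.2 i)).2 (abs_le.1 (hM ξ ξ.2 i)).1 (y i) (z i)
    simp only [mul_sub, Finset.sum_sub_distrib] at this ⊢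
    linarith
  · have h1 := le_ciSup (hbdd2 x) ξ
    have h2 := Finset.sum_le_sum fun i (_ : i ∈ Finset.univ) =>
      mul_sub_mul_expLogLaplace_le_expCost (hlt ξ ξ.2 i) (hx i) (hy i)
    simp only [mul_sub, Finset.sum_sub_distrib, mul_one, mul_comm (x _)] at h1 h2 ⊢
    linarith
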